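/- arXiv:2303.01695 — 5 statements merged into one kernel-verified Lean document; each statement's English description precedes it below -/
import Mathlib

section
/- Let 0 < α < 1, let δ > 0, let μx, μy be real numbers with μx > μy, and let kx, ky be natural numbers with kx > ky. Define S = (μx − μy)/(δ·(√(2·kx) − √(2·ky))). If α ≥ exp(−S²), then μx − δ·√(2·ln(1/α)·kx) ≥ μy − δ·√(2·ln(1/α)·ky). -/
theorem hoeffding_threshold_implies_profit_ge
    (α δ μx μy : ℝ) (kx ky : ℕ)
    (hα0 : 0 < α) (hα1 : α < 1) (hδ : δ > 0)
    (hμ : μx > μy) (hk : kx > ky)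
    (S : ℝ)
    (hS : S = (μx - μy) / (δ * (Real.sqrt (2 * kx) - Real.sqrt (2 * ky))))
    (hαS : α ≥ Real.exp (-S ^ 2)) :
    μx - δ * Real.sqrt (2 * Real.log (1 / α) * kx) ≥
      μy - δ * Real.sqrt (2 * Real.log (1 / α) * ky) := by
  have hk' : (ky : ℝ) < kx := by exact_mod_cast hk
  have hlt : Real.sqrt (2 * ky) < Real.sqrt (2 * kx) :=
    Real.sqrt_lt_sqrt (by positivity) (by linarith)
  have hD : 0 < δ * (Real.sqrt (2 * kx) - Real.sqrt (2 * ky)) :=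
    mul_pos hδ (by linarith)
  have hS0 : 0 ≤ S := by
    rw [hS]
    exact div_nonneg (by linarith) hD.le
  have hlog : -S ^ 2 ≤ Real.log α := (Real.le_log_iff_exp_le hα0).2 hαS
  have hL : Real.log (1 / α) = -Real.log α := by
    rw [one_div, Real.log_inv]
  have hL0 : 0 ≤ Real.log (1 / α) := by
    rw [hL]
    linarith [Real.log_neg hα0 hα1]
  have hsq : Real.sqrt (Real.log (1 / α)) ≤ S :=
    Real.sqrt_le_iff.2 ⟨hS0, by rw [hL]; linarith⟩
  have key : ∀ k : ℝ, Real.sqrt (2 * Real.log (1 / α) * k)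
      = Real.sqrt (Real.log (1 / α)) * Real.sqrt (2 * k) := by
    intro k
    rw [← Real.sqrt_mul hL0]
    congr 1
    ring
  rw [key, key]
  rw [hS, le_div_iff₀ hD] at hsq
  nlinarith [hsq]
end

section
/- Let 0 < α < 1, let δ > 0, let μx, μy be real numbers with μx > μy, and let kx, ky be natural numbers with kx > ky. Define S = (μx − μy)/(δ·(√(2·kx) − √(2·ky))). Then α ≥ exp(−S²) holds if and only if μx − δ·√(2·ln(1/α)·kx) ≥ μy − δ·√(2·ln(1/α)·ky). -/
theorem hoeffding_threshold_iff_profit_ge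
    (α δ μx μy : ℝ) (kx ky : ℕ)
    (hα0 : 0 < α) (hα1 : α < 1) (hδ : δ > 0)
    (hμ : μx > μy) (hk : kx > ky)
    (S : ℝ)
    (hS : S = (μx - μy) / (δ * (Real.sqrt (2 * kx) - Real.sqrt (2 * ky)))) :
    α ≥ Real.exp (-S ^ 2) ↔
      μx - δ * Real.sqrt (2 * Real.log (1 / α) * kx) ≥
        μy - δ * Real.sqrt (2 * Real.log (1 / α) * ky) := by
  have hL : 0 < Real.log (1 / α) := Real.log_pos (by rw [lt_div_iff₀ hα0]; linarith)
  have hLe : Real.log (1 / α) = -Real.log α := by rw [one_div, Real.log_inv]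
  have hk' : (ky : ℝ) < kx := by exact_mod_cast hk
  have hD : Real.sqrt (2 * ky) < Real.sqrt (2 * kx) :=
    Real.sqrt_lt_sqrt (by positivity) (by linarith)
  have hE : 0 < δ * (Real.sqrt (2 * kx) - Real.sqrt (2 * ky)) :=
    mul_pos hδ (sub_pos.mpr hD)
  have hS0 : 0 ≤ S := by
    rw [hS]
    exact div_nonneg (by linarith) hE.le
  have h1 : ∀ k : ℕ, Real.sqrt (2 * Real.log (1 / α) * k)
      = Real.sqrt (Real.log (1 / α)) * Real.sqrt (2 * k) := by
    intro k
    rw [← Real.sqrt_mul hL.le]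
    congr 1
    ring
  have h2 : α ≥ Real.exp (-S ^ 2) ↔ Real.sqrt (Real.log (1 / α)) ≤ S := by
    rw [Real.sqrt_le_left hS0, hLe, ge_iff_le, ← Real.le_log_iff_exp_le hα0]
    constructor <;> intro h <;> linarith
  rw [h2, h1, h1, hS, le_div_iff₀ hE]
  constructor <;> intro h <;> linarith
end

section
/- Let 0 < α < 1, let δ > 0, let μx, μy be real numbers with μx > μy, and let kx, ky be natural numbers with kx > ky. Define S = (μx − μy)/(δ·(√(2·kx) − √(2·ky))). If α > exp(−S²), then μx − δ·√(2·ln(1/α)·kx) > μy − δ·√(2·ln(1/α)·ky) (strict inequality). -/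
theorem hoeffding_threshold_implies_profit_gt
    (α δ μx μy : ℝ) (kx ky : ℕ)
    (hα0 : 0 < α) (hα1 : α < 1) (hδ : δ > 0)
    (hμ : μx > μy) (hk : kx > ky)
    (S : ℝ)
    (hS : S = (μx - μy) / (δ * (Real.sqrt (2 * kx) - Real.sqrt (2 * ky))))
    (hαS : α > Real.exp (-S ^ 2)) :
    μx - δ * Real.sqrt (2 * Real.log (1 / α) * kx) >
      μy - δ * Real.sqrt (2 * Real.log (1 / α) * ky) := by
  have hkk : (ky : ℝ) < kx := by exact_mod_cast hk
  have hlt : Real.sqrt (2 * ky) < Real.sqrt (2 * kx) :=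
    Real.sqrt_lt_sqrt (by positivity) (by linarith)
  have hD : 0 < δ * (Real.sqrt (2 * kx) - Real.sqrt (2 * ky)) :=
    mul_pos hδ (by linarith)
  have hS0 : 0 < S := by
    rw [hS]
    exact div_pos (by linarith) hD
  have hlog : Real.log (1 / α) = -Real.log α := by
    rw [one_div, Real.log_inv]
  have hL0 : 0 ≤ Real.log (1 / α) := by
    have := Real.log_neg hα0 hα1
    linarith
  have hL : Real.log (1 / α) < S ^ 2 := by
    have := (Real.lt_log_iff_exp_lt hα0).2 hαS
    linarith
  have hsq : Real.sqrt (Real.log (1 / α)) < S := (Real.sqrt_lt' hS0).2 hL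
  have e : ∀ k : ℝ, Real.sqrt (2 * Real.log (1 / α) * k)
      = Real.sqrt (Real.log (1 / α)) * Real.sqrt (2 * k) := by
    intro k
    rw [← Real.sqrt_mul hL0]
    congr 1
    ring
  rw [e, e]
  rw [hS, lt_div_iff₀ hD] at hsq
  linarith
end

section
/- Let 0 < α < 1 and let x, y, z be three solutions with expected profits μx > μy > μz and profit variances vx > vy > vz ≥ 0. Define R(a,b) = (μa − μb)/(√va − √vb) and the thresholds α(a,b) = 1/(1 + R(a,b)²). Then the middle solution y satisfies both p̂_Cheb(y, α) ≥ p̂_Cheb(x, α) and p̂_Cheb(y, α) ≥ p̂_Cheb(z, α) if and only if α(y,z) ≤ α ≤ α(x,y), where p̂_Cheb(a, α) = μa − √((1−α)/α)·√va. -/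
theorem chebyshev_confidence_interval_three_solutions
    (α μx μy μz vx vy vz : ℝ)
    (hα0 : 0 < α) (hα1 : α < 1)
    (hμxy : μx > μy) (hμyz : μy > μz)
    (hvxy : vx > vy) (hvyz : vy > vz) (hvz : vz ≥ 0)
    (Rxy Ryz αxy αyz : ℝ)
    (hRxy : Rxy = (μx - μy) / (Real.sqrt vx - Real.sqrt vy))
    (hRyz : Ryz = (μy - μz) / (Real.sqrt vy - Real.sqrt vz))
    (hαxy : αxy = 1 / (1 + Rxy ^ 2))
    (hαyz : αyz = 1 / (1 + Ryz ^ 2)) :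
    (μy - Real.sqrt ((1 - α) / α) * Real.sqrt vy ≥
        μx - Real.sqrt ((1 - α) / α) * Real.sqrt vx ∧
      μy - Real.sqrt ((1 - α) / α) * Real.sqrt vy ≥
        μz - Real.sqrt ((1 - α) / α) * Real.sqrt vz) ↔
      (αyz ≤ α ∧ α ≤ αxy) := by
  have sxy : 0 < Real.sqrt vx - Real.sqrt vy :=
    sub_pos.2 (Real.sqrt_lt_sqrt (by linarith) hvxy)
  have syz : 0 < Real.sqrt vy - Real.sqrt vz :=
    sub_pos.2 (Real.sqrt_lt_sqrt hvz hvyz)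
  have pxy : 0 < Rxy := hRxy ▸ div_pos (by linarith) sxy
  have pyz : 0 < Ryz := hRyz ▸ div_pos (by linarith) syz
  have h1 : μy - Real.sqrt ((1 - α) / α) * Real.sqrt vy ≥
        μx - Real.sqrt ((1 - α) / α) * Real.sqrt vx ↔ Rxy ≤ Real.sqrt ((1 - α) / α) := by
    rw [hRxy, div_le_iff₀ sxy, mul_sub]
    constructor <;> intro h <;> linarith
  have h2 : μy - Real.sqrt ((1 - α) / α) * Real.sqrt vy ≥
        μz - Real.sqrt ((1 - α) / α) * Real.sqrt vz ↔ Real.sqrt ((1 - α) / α) ≤ Ryz := by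
    rw [hRyz, le_div_iff₀ syz, mul_sub]
    constructor <;> intro h <;> linarith
  have h3 : Rxy ≤ Real.sqrt ((1 - α) / α) ↔ α ≤ αxy := by
    rw [Real.le_sqrt' pxy, hαxy, le_div_iff₀ hα0, le_div_iff₀ (by positivity)]
    constructor <;> intro h <;> linarith
  have h4 : Real.sqrt ((1 - α) / α) ≤ Ryz ↔ αyz ≤ α := by
    rw [Real.sqrt_le_left pyz.le, hαyz, div_le_iff₀ hα0, div_le_iff₀ (by positivity)]
    constructor <;> intro h <;> linarith
  rw [h1, h2, h3, h4, and_comm]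
end

section
/- Let 0 < α < 1, δ > 0, and let x, y, z be three solutions with expected profits μx > μy > μz and item counts kx > ky > kz (natural numbers). Define S(a,b) = (μa − μb)/(δ·(√(2·ka) − √(2·kb))) and the thresholds α(a,b) = exp(−S(a,b)²). Then the middle solution y satisfies both p̂_Hoef(y, α) ≥ p̂_Hoef(x, α) and p̂_Hoef(y, α) ≥ p̂_Hoef(z, α) if and only if α(y,z) ≤ α ≤ α(x,y), where p̂_Hoef(a, α) = μa − δ·√(2·ln(1/α)·ka). -/
theorem hoeffding_confidence_interval_three_solutions
    (α δ μx μy μz : ℝ) (kx ky kz : ℕ)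
    (hα0 : 0 < α) (hα1 : α < 1) (hδ : δ > 0)
    (hμxy : μx > μy) (hμyz : μy > μz)
    (hkxy : kx > ky) (hkyz : ky > kz)
    (Sxy Syz αxy αyz : ℝ)
    (hSxy : Sxy = (μx - μy) / (δ * (Real.sqrt (2 * kx) - Real.sqrt (2 * ky))))
    (hSyz : Syz = (μy - μz) / (δ * (Real.sqrt (2 * ky) - Real.sqrt (2 * kz))))
    (hαxy : αxy = Real.exp (-Sxy ^ 2))
    (hαyz : αyz = Real.exp (-Syz ^ 2)) :
    (μy - δ * Real.sqrt (2 * Real.log (1 / α) * ky) ≥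
        μx - δ * Real.sqrt (2 * Real.log (1 / α) * kx) ∧
      μy - δ * Real.sqrt (2 * Real.log (1 / α) * ky) ≥
        μz - δ * Real.sqrt (2 * Real.log (1 / α) * kz)) ↔
      (αyz ≤ α ∧ α ≤ αxy) := by
  have hL : 0 < Real.log (1 / α) := Real.log_pos (by rw [lt_div_iff₀ hα0]; linarith)
  have hlog : Real.log α = -Real.log (1 / α) := by simp
  have key : ∀ k : ℕ, Real.sqrt (2 * Real.log (1 / α) * k)
      = Real.sqrt (Real.log (1 / α)) * Real.sqrt (2 * k) := by
    intro k
    rw [← Real.sqrt_mul hL.le]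
    congr 1
    ring
  have hsq : Real.sqrt (Real.log (1 / α)) ^ 2 = Real.log (1 / α) := Real.sq_sqrt hL.le
  have hL0 : 0 ≤ Real.sqrt (Real.log (1 / α)) := Real.sqrt_nonneg _
  have hlt : ∀ a b : ℕ, b < a → Real.sqrt (2 * b) < Real.sqrt (2 * a) := by
    intro a b h
    have h' : (b : ℝ) < a := by exact_mod_cast h
    exact Real.sqrt_lt_sqrt (by positivity) (by linarith)
  have h1 : 0 < δ * (Real.sqrt (2 * kx) - Real.sqrt (2 * ky)) :=
    mul_pos hδ (sub_pos.2 (hlt _ _ hkxy))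
  have h2 : 0 < δ * (Real.sqrt (2 * ky) - Real.sqrt (2 * kz)) :=
    mul_pos hδ (sub_pos.2 (hlt _ _ hkyz))
  have hS1 : 0 ≤ Sxy := by rw [hSxy]; exact div_nonneg (by linarith) h1.le
  have hS2 : 0 ≤ Syz := by rw [hSyz]; exact div_nonneg (by linarith) h2.le
  have e1 : α ≤ αxy ↔ Sxy ≤ Real.sqrt (Real.log (1 / α)) := by
    rw [hαxy, ← Real.log_le_iff_le_exp hα0, hlog, neg_le_neg_iff, ← Real.le_sqrt' ] <;>
      first | exact hS1 | skip
    rw [hSxy]; exact div_pos (by linarith) h1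
  have e2 : αyz ≤ α ↔ Real.sqrt (Real.log (1 / α)) ≤ Syz := by
    rw [hαyz, ← Real.le_log_iff_exp_le hα0, hlog, neg_le_neg_iff, Real.sqrt_le_left hS2]
  rw [e1, e2, key, key, key, hSxy, hSyz, div_le_iff₀ h1, le_div_iff₀ h2]
  constructor
  · rintro ⟨a, b⟩
    constructor <;> linarith
  · rintro ⟨a, b⟩
    constructor <;> linarith
end
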